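/- Let I = v₁·B_q be the right ideal of B_q generated by the isotropic element v₁, and let I₀ = I ∩ B_{q0} and I₁ = I ∩ B_{q1} be its even and odd parts. Then I₀ and I₁ are each 4-dimensional k-vector spaces; explicitly, {v₁v₂, v₁e₃, v₁e₄, v₁v₂e₃e₄} is a k-basis of I₀ and {v₁, v₁v₂e₃, v₁v₂e₄, v₁e₃e₄} is a k-basis of I₁. -/

import Mathlib

open CliffordAlgebra

noncomputable def qForm (k : Type) [Field k] (lam mu : k) : QuadraticForm k (Fin 4 → k) :=
  LinearMap.BilinMap.toQuadraticMap <|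
    LinearMap.mk₂ k (fun x y => x 0 * y 1 + lam * (x 2 * y 2) + mu * (x 3 * y 3))
      (fun x x' y => by simp; ring)
      (fun c x y => by simp; ring)
      (fun x y y' => by simp; ring)
      (fun c x y => by simp; ring)

noncomputable def cV1 (k : Type) [Field k] (lam mu : k) : CliffordAlgebra (qForm k lam mu) :=
  ι (qForm k lam mu) (Pi.single 0 1)

noncomputable def cV2 (k : Type) [Field k] (lam mu : k) : CliffordAlgebra (qForm k lam mu) :=
  ι (qForm k lam mu) (Pi.single 1 1)

noncomputable def cE3 (k : Type) [Field k] (lam mu : k) : CliffordAlgebra (qForm k lam mu) :=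
  ι (qForm k lam mu) (Pi.single 2 1)

noncomputable def cE4 (k : Type) [Field k] (lam mu : k) : CliffordAlgebra (qForm k lam mu) :=
  ι (qForm k lam mu) (Pi.single 3 1)

noncomputable def cE1 (k : Type) [Field k] (lam mu : k) : CliffordAlgebra (qForm k lam mu) :=
  cV1 k lam mu + cV2 k lam mu

noncomputable def cE2 (k : Type) [Field k] (lam mu : k) : CliffordAlgebra (qForm k lam mu) :=
  cV2 k lam mu - cV1 k lam mu

noncomputable def cD (k : Type) [Field k] (lam mu : k) : CliffordAlgebra (qForm k lam mu) :=
  cE1 k lam mu * cE2 k lam mu * cE3 k lam mu * cE4 k lam mu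

theorem aux_q (k : Type) [Field k] (lam mu : k) (x : Fin 4 → k) :
    qForm k lam mu x = x 0 * x 1 + lam * (x 2 * x 2) + mu * (x 3 * x 3) := rfl

theorem aux_rels (k : Type) [Field k] (lam mu : k) :
    cV1 k lam mu * cV1 k lam mu = 0 ∧ cV2 k lam mu * cV2 k lam mu = 0 ∧
    cE3 k lam mu * cE3 k lam mu = lam • 1 ∧ cE4 k lam mu * cE4 k lam mu = mu • 1 ∧
    cV2 k lam mu * cV1 k lam mu = 1 - cV1 k lam mu * cV2 k lam mu ∧
    cE3 k lam mu * cV1 k lam mu = -(cV1 k lam mu * cE3 k lam mu) ∧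
    cE4 k lam mu * cV1 k lam mu = -(cV1 k lam mu * cE4 k lam mu) ∧
    cE3 k lam mu * cV2 k lam mu = -(cV2 k lam mu * cE3 k lam mu) ∧
    cE4 k lam mu * cV2 k lam mu = -(cV2 k lam mu * cE4 k lam mu) ∧
    cE4 k lam mu * cE3 k lam mu = -(cE3 k lam mu * cE4 k lam mu) := by
  refine ⟨?_, ?_, ?_, ?_, ?_, ?_, ?_, ?_, ?_, ?_⟩
  · rw [cV1, ι_sq_scalar]; simp [aux_q]
  · rw [cV2, ι_sq_scalar]; simp [aux_q]
  · rw [cE3, ι_sq_scalar]; simp [aux_q, Algebra.algebraMap_eq_smul_one]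
  · rw [cE4, ι_sq_scalar]; simp [aux_q, Algebra.algebraMap_eq_smul_one]
  all_goals
    simp only [cV1, cV2, cE3, cE4]
    rw [ι_mul_ι_comm]
    simp [QuadraticMap.polar, aux_q]

/-- Right multiplication on the two spans, in an abstract algebra with the relations. -/
theorem aux_mul {k A : Type} [Field k] [Ring A] [Algebra k A] (lam mu : k) (a b c d : A)
    (haa : a * a = 0) (hbb : b * b = 0) (hcc : c * c = lam • 1) (hdd : d * d = mu • 1)
    (hba : b * a = 1 - a * b) (hca : c * a = -(a * c)) (hda : d * a = -(a * d))
    (hcb : c * b = -(b * c)) (hdb : d * b = -(b * d)) (hdc : d * c = -(c * d))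
    (x : A) (hx : x = a ∨ x = b ∨ x = c ∨ x = d) :
    (∀ y ∈ Submodule.span k (Set.range ![a * b, a * c, a * d, a * b * c * d]),
      y * x ∈ Submodule.span k (Set.range ![a, a * b * c, a * b * d, a * c * d])) ∧
    (∀ y ∈ Submodule.span k (Set.range ![a, a * b * c, a * b * d, a * c * d]),
      y * x ∈ Submodule.span k (Set.range ![a * b, a * c, a * d, a * b * c * d])) := by
  have haa' (x : A) : a * (a * x) = 0 := by rw [← mul_assoc, haa, zero_mul]
  have hbb' (x : A) : b * (b * x) = 0 := by rw [← mul_assoc, hbb, zero_mul]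
  have hcc' (x : A) : c * (c * x) = lam • x := by rw [← mul_assoc, hcc, smul_one_mul]
  have hdd' (x : A) : d * (d * x) = mu • x := by rw [← mul_assoc, hdd, smul_one_mul]
  have hba' (x : A) : b * (a * x) = x - a * (b * x) := by
    rw [← mul_assoc, hba, sub_mul, one_mul, mul_assoc]
  have hca' (x : A) : c * (a * x) = -(a * (c * x)) := by rw [← mul_assoc, hca, neg_mul, mul_assoc]
  have hda' (x : A) : d * (a * x) = -(a * (d * x)) := by rw [← mul_assoc, hda, neg_mul, mul_assoc]
  have hcb' (x : A) : c * (b * x) = -(b * (c * x)) := by rw [← mul_assoc, hcb, neg_mul, mul_assoc]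
  have hdb' (x : A) : d * (b * x) = -(b * (d * x)) := by rw [← mul_assoc, hdb, neg_mul, mul_assoc]
  have hdc' (x : A) : d * (c * x) = -(c * (d * x)) := by rw [← mul_assoc, hdc, neg_mul, mul_assoc]
  constructor
  · set S := Submodule.span k (Set.range ![a, a * b * c, a * b * d, a * c * d]) with hS
    have h0 : a ∈ S := Submodule.subset_span ⟨0, rfl⟩
    have h1 : a * (b * c) ∈ S := Submodule.subset_span ⟨1, by simp [mul_assoc]⟩
    have h2 : a * (b * d) ∈ S := Submodule.subset_span ⟨2, by simp [mul_assoc]⟩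
    have h3 : a * (c * d) ∈ S := Submodule.subset_span ⟨3, by simp [mul_assoc]⟩
    clear_value S
    clear hS
    intro y hy
    induction hy using Submodule.span_induction with
    | mem y hy =>
      obtain ⟨i, rfl⟩ := hy
      rcases hx with rfl | rfl | rfl | rfl <;> fin_cases i <;>
        simp [mul_assoc, mul_sub, *, Submodule.smul_mem]
    | zero => simp
    | add y z _ _ h h' => rw [add_mul]; exact add_mem h h'
    | smul r y _ h => rw [smul_mul_assoc]; exact Submodule.smul_mem _ _ h
  · set S := Submodule.span k (Set.range ![a * b, a * c, a * d, a * b * c * d]) with hS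
    have h0 : a * b ∈ S := Submodule.subset_span ⟨0, rfl⟩
    have h1 : a * c ∈ S := Submodule.subset_span ⟨1, by simp⟩
    have h2 : a * d ∈ S := Submodule.subset_span ⟨2, by simp⟩
    have h3 : a * (b * (c * d)) ∈ S := Submodule.subset_span ⟨3, by simp [mul_assoc]⟩
    clear_value S
    clear hS
    intro y hy
    induction hy using Submodule.span_induction with
    | mem y hy =>
      obtain ⟨i, rfl⟩ := hy
      rcases hx with rfl | rfl | rfl | rfl <;> fin_cases i <;>
        simp [mul_assoc, mul_sub, *, Submodule.smul_mem]
    | zero => simp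
    | add y z _ _ h h' => rw [add_mul]; exact add_mem h h'
    | smul r y _ h => rw [smul_mul_assoc]; exact Submodule.smul_mem _ _ h

theorem aux_iota (k : Type) [Field k] (lam mu : k) (m : Fin 4 → k) :
    ι (qForm k lam mu) m = m 0 • cV1 k lam mu + m 1 • cV2 k lam mu + m 2 • cE3 k lam mu
      + m 3 • cE4 k lam mu := by
  simp only [cV1, cV2, cE3, cE4, ← map_smul, ← map_add]
  congr 1
  ext i
  fin_cases i <;> simp

theorem aux_mul_iota (k : Type) [Field k] (lam mu : k) (m : Fin 4 → k)
    (S T : Submodule k (CliffordAlgebra (qForm k lam mu)))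
    (h : ∀ x, (x = cV1 k lam mu ∨ x = cV2 k lam mu ∨ x = cE3 k lam mu ∨ x = cE4 k lam mu) →
      ∀ y ∈ S, y * x ∈ T) (y : _) (hy : y ∈ S) : y * ι (qForm k lam mu) m ∈ T := by
  rw [aux_iota]
  simp only [mul_add, mul_smul_comm]
  refine add_mem (add_mem (add_mem ?_ ?_) ?_) ?_ <;> apply Submodule.smul_mem <;>
    exact h _ (by simp) y hy

theorem aux_li0 (k : Type) [Field k] [CharZero k] (lam mu : k) : LinearIndependent k
         ![cV1 k lam mu * cV2 k lam mu, cV1 k lam mu * cE3 k lam mu,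
           cV1 k lam mu * cE4 k lam mu,
           cV1 k lam mu * cV2 k lam mu * cE3 k lam mu * cE4 k lam mu] := by
  haveI : Invertible (2 : k) := invertibleOfNonzero two_ne_zero
  rw [Fintype.linearIndependent_iff]
  intro g hg
  simp only [Fin.sum_univ_four, cV1, cV2, cE3, cE4, mul_assoc] at hg
  let D (i : Fin 4) : Module.Dual k (Fin 4 → k) := LinearMap.proj i
  have e3 := congrArg (fun x => contractLeft (D 3) (contractLeft (D 2)
    (contractLeft (D 1) (contractLeft (D 0) x)))) hg
  simp [contractLeft_ι_mul, contractLeft_ι, D, Algebra.algebraMap_eq_smul_one] at e3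
  have e0 := congrArg (fun x => contractLeft (D 1) (contractLeft (D 0) x)) hg
  simp [contractLeft_ι_mul, contractLeft_ι, D, Algebra.algebraMap_eq_smul_one, e3] at e0
  have e1 := congrArg (fun x => contractLeft (D 2) (contractLeft (D 0) x)) hg
  simp [contractLeft_ι_mul, contractLeft_ι, D, Algebra.algebraMap_eq_smul_one, e3] at e1
  have e2 := congrArg (fun x => contractLeft (D 3) (contractLeft (D 0) x)) hg
  simp [contractLeft_ι_mul, contractLeft_ι, D, Algebra.algebraMap_eq_smul_one, e3] at e2
  intro i
  fin_cases i <;> assumption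

theorem aux_li1 (k : Type) [Field k] [CharZero k] (lam mu : k) : LinearIndependent k
         ![cV1 k lam mu, cV1 k lam mu * cV2 k lam mu * cE3 k lam mu,
           cV1 k lam mu * cV2 k lam mu * cE4 k lam mu,
           cV1 k lam mu * cE3 k lam mu * cE4 k lam mu] := by
  haveI : Invertible (2 : k) := invertibleOfNonzero two_ne_zero
  rw [Fintype.linearIndependent_iff]
  intro g hg
  simp only [Fin.sum_univ_four, cV1, cV2, cE3, cE4, mul_assoc] at hg
  let D (i : Fin 4) : Module.Dual k (Fin 4 → k) := LinearMap.proj i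
  have e1 := congrArg (fun x => contractLeft (D 2) (contractLeft (D 1)
    (contractLeft (D 0) x))) hg
  simp [contractLeft_ι_mul, contractLeft_ι, D, Algebra.algebraMap_eq_smul_one] at e1
  have e2 := congrArg (fun x => contractLeft (D 3) (contractLeft (D 1)
    (contractLeft (D 0) x))) hg
  simp [contractLeft_ι_mul, contractLeft_ι, D, Algebra.algebraMap_eq_smul_one] at e2
  have e3 := congrArg (fun x => contractLeft (D 3) (contractLeft (D 2)
    (contractLeft (D 0) x))) hg
  simp [contractLeft_ι_mul, contractLeft_ι, D, Algebra.algebraMap_eq_smul_one] at e3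
  have e0 := congrArg (fun x => contractLeft (D 0) x) hg
  simp [contractLeft_ι_mul, contractLeft_ι, D, Algebra.algebraMap_eq_smul_one, e1, e2, e3] at e0
  intro i
  fin_cases i <;> assumption

theorem aux_mul_mem {k M : Type} [Field k] [AddCommGroup M] [Module k M] {Q : QuadraticForm k M}
    {i j l : ZMod 2} {x y : CliffordAlgebra Q} (hx : x ∈ evenOdd Q i) (hy : y ∈ evenOdd Q j)
    (h : i + j = l) : x * y ∈ evenOdd Q l :=
  h ▸ evenOdd_mul_le Q i j (Submodule.mul_mem_mul hx hy)

/-- for `I = v₁·B_q` the right ideal generated by `v₁`, with even and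
odd parts `I₀ = I ∩ B_{q0}` and `I₁ = I ∩ B_{q1}`, both `I₀` and `I₁` are
4-dimensional over `k`; `{v₁v₂, v₁e₃, v₁e₄, v₁v₂e₃e₄}` is a basis of `I₀` and
`{v₁, v₁v₂e₃, v₁v₂e₄, v₁e₃e₄}` is a basis of `I₁`. -/
theorem stmt_10 (k : Type) [Field k] [CharZero k] (lam mu : k) :
    ∀ I : Submodule k (CliffordAlgebra (qForm k lam mu)),
      I = LinearMap.range (LinearMap.mulLeft k (cV1 k lam mu)) →
      (Module.finrank k ↥(I ⊓ CliffordAlgebra.evenOdd (qForm k lam mu) 0) = 4 ∧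
       Module.finrank k ↥(I ⊓ CliffordAlgebra.evenOdd (qForm k lam mu) 1) = 4 ∧
       LinearIndependent k
         ![cV1 k lam mu * cV2 k lam mu, cV1 k lam mu * cE3 k lam mu,
           cV1 k lam mu * cE4 k lam mu,
           cV1 k lam mu * cV2 k lam mu * cE3 k lam mu * cE4 k lam mu] ∧
       Submodule.span k
         (Set.range
           ![cV1 k lam mu * cV2 k lam mu, cV1 k lam mu * cE3 k lam mu,
             cV1 k lam mu * cE4 k lam mu,
             cV1 k lam mu * cV2 k lam mu * cE3 k lam mu * cE4 k lam mu]) =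
         I ⊓ CliffordAlgebra.evenOdd (qForm k lam mu) 0 ∧
       LinearIndependent k
         ![cV1 k lam mu, cV1 k lam mu * cV2 k lam mu * cE3 k lam mu,
           cV1 k lam mu * cV2 k lam mu * cE4 k lam mu,
           cV1 k lam mu * cE3 k lam mu * cE4 k lam mu] ∧
       Submodule.span k
         (Set.range
           ![cV1 k lam mu, cV1 k lam mu * cV2 k lam mu * cE3 k lam mu,
             cV1 k lam mu * cV2 k lam mu * cE4 k lam mu,
             cV1 k lam mu * cE3 k lam mu * cE4 k lam mu]) =
         I ⊓ CliffordAlgebra.evenOdd (qForm k lam mu) 1) := by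
  intro I hI
  have l0 := aux_li0 k lam mu
  have l1 := aux_li1 k lam mu
  have key : ∀ x, (x = cV1 k lam mu ∨ x = cV2 k lam mu ∨ x = cE3 k lam mu ∨ x = cE4 k lam mu) → _ :=
    fun x hx => by
      obtain ⟨haa, hbb, hcc, hdd, hba, hca, hda, hcb, hdb, hdc⟩ := aux_rels k lam mu
      exact aux_mul lam mu _ _ _ _ haa hbb hcc hdd hba hca hda hcb hdb hdc x hx
  have o1 : cV1 k lam mu ∈ evenOdd (qForm k lam mu) 1 := ι_mem_evenOdd_one _ _
  have o2 : cV2 k lam mu ∈ evenOdd (qForm k lam mu) 1 := ι_mem_evenOdd_one _ _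
  have o3 : cE3 k lam mu ∈ evenOdd (qForm k lam mu) 1 := ι_mem_evenOdd_one _ _
  have o4 : cE4 k lam mu ∈ evenOdd (qForm k lam mu) 1 := ι_mem_evenOdd_one _ _
  have z : (1 : ZMod 2) + 1 = 0 := rfl
  set S0 := Submodule.span k
         (Set.range
           ![cV1 k lam mu * cV2 k lam mu, cV1 k lam mu * cE3 k lam mu,
             cV1 k lam mu * cE4 k lam mu,
             cV1 k lam mu * cV2 k lam mu * cE3 k lam mu * cE4 k lam mu]) with hS0
  set S1 := Submodule.span k
         (Set.range
           ![cV1 k lam mu, cV1 k lam mu * cV2 k lam mu * cE3 k lam mu,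
             cV1 k lam mu * cV2 k lam mu * cE4 k lam mu,
             cV1 k lam mu * cE3 k lam mu * cE4 k lam mu]) with hS1
  have s0 : S0 ≤ I ⊓ evenOdd (qForm k lam mu) 0 := by
    rw [hS0, Submodule.span_le, hI]
    rintro _ ⟨i, rfl⟩
    fin_cases i
    · exact ⟨⟨cV2 k lam mu, rfl⟩, aux_mul_mem o1 o2 z⟩
    · exact ⟨⟨cE3 k lam mu, rfl⟩, aux_mul_mem o1 o3 z⟩
    · exact ⟨⟨cE4 k lam mu, rfl⟩, aux_mul_mem o1 o4 z⟩
    · exact ⟨⟨cV2 k lam mu * cE3 k lam mu * cE4 k lam mu, by simp [mul_assoc]⟩,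
        aux_mul_mem (aux_mul_mem (aux_mul_mem o1 o2 z) o3 (zero_add _)) o4 z⟩
  have s1 : S1 ≤ I ⊓ evenOdd (qForm k lam mu) 1 := by
    rw [hS1, Submodule.span_le, hI]
    rintro _ ⟨i, rfl⟩
    fin_cases i
    · exact ⟨⟨1, by simp⟩, o1⟩
    · exact ⟨⟨cV2 k lam mu * cE3 k lam mu, by simp [mul_assoc]⟩,
        aux_mul_mem (aux_mul_mem o1 o2 z) o3 (zero_add _)⟩
    · exact ⟨⟨cV2 k lam mu * cE4 k lam mu, by simp [mul_assoc]⟩,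
        aux_mul_mem (aux_mul_mem o1 o2 z) o4 (zero_add _)⟩
    · exact ⟨⟨cE3 k lam mu * cE4 k lam mu, by simp [mul_assoc]⟩,
        aux_mul_mem (aux_mul_mem o1 o3 z) o4 (zero_add _)⟩
  have dec : ∀ x, ∃ u ∈ S0, ∃ v ∈ S1, cV1 k lam mu * x = u + v := by
    intro x
    induction x using CliffordAlgebra.right_induction with
    | algebraMap r =>
      refine ⟨0, zero_mem _, r • cV1 k lam mu,
        Submodule.smul_mem _ _ (Submodule.subset_span ⟨0, rfl⟩), ?_⟩
      simp [Algebra.algebraMap_eq_smul_one]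
    | add x y hx hy =>
      obtain ⟨u, hu, v, hv, h⟩ := hx
      obtain ⟨u', hu', v', hv', h'⟩ := hy
      exact ⟨u + u', add_mem hu hu', v + v', add_mem hv hv', by rw [mul_add, h, h']; abel⟩
    | mul_ι m x hx =>
      obtain ⟨u, hu, v, hv, h⟩ := hx
      refine ⟨v * ι _ m, aux_mul_iota k lam mu m S1 S0 (fun x hx => (key x hx).2) v hv,
        u * ι _ m, aux_mul_iota k lam mu m S0 S1 (fun x hx => (key x hx).1) u hu, ?_⟩
      rw [← mul_assoc, h, add_mul, add_comm]
  have disj := (evenOdd_isCompl (qForm k lam mu)).disjoint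
  rw [Submodule.disjoint_def] at disj
  have t0 : S0 = I ⊓ evenOdd (qForm k lam mu) 0 := by
    refine le_antisymm s0 ?_
    rintro w ⟨hw, hw0⟩
    rw [hI] at hw
    obtain ⟨x, rfl⟩ := hw
    obtain ⟨u, hu, v, hv, h⟩ := dec x
    rw [LinearMap.mulLeft_apply] at hw0 ⊢
    have : v = 0 := disj v (by
      have : v = cV1 k lam mu * x - u := by rw [h]; abel
      rw [this]; exact sub_mem hw0 (s0 hu).2) (s1 hv).2
    rw [h, this, add_zero]; exact hu
  have t1 : S1 = I ⊓ evenOdd (qForm k lam mu) 1 := by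
    refine le_antisymm s1 ?_
    rintro w ⟨hw, hw0⟩
    rw [hI] at hw
    obtain ⟨x, rfl⟩ := hw
    obtain ⟨u, hu, v, hv, h⟩ := dec x
    rw [LinearMap.mulLeft_apply] at hw0 ⊢
    have : u = 0 := disj u (s0 hu).2 (by
      have : u = cV1 k lam mu * x - v := by rw [h]; abel
      rw [this]; exact sub_mem hw0 (s1 hv).2)
    rw [h, this, zero_add]; exact hv
  refine ⟨?_, ?_, l0, t0, l1, t1⟩
  · rw [← t0, hS0, finrank_span_eq_card l0]; rfl
  · rw [← t1, hS1, finrank_span_eq_card l1]; rfl
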